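/- arXiv:2304.07776 — 4 statements merged into one kernel-verified Lean document; each statement's English description precedes it below -/
import Mathlib

section
/- Let i be the digit sequence i₁,…,i_{m-1}, i_m, 0, 0, 0, … with i_m ≠ 0, and let j be the digit sequence i₁,…,i_{m-1}, i_m−1, 2, 2, 2, …. Then val(i) = val(j) (the two sequences are the two P₃-representations of the same P₃-rational number), but val(θ∘i) ≠ val(θ∘j). In particular, defining f(val(i)) = val(θ∘i) gives different values on the two representations of a P₃-rational number. -/
open Filter MeasureTheory Finset

/-- The "beta" values `β₀ = 0`, `β₁ = p₀`, `β₂ = p₀ + p₁` associated with weights `p`. -/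
noncomputable def P3beta (p : Fin 3 → ℝ) : Fin 3 → ℝ := ![0, p 0, p 0 + p 1]

/-- The P₃-value of a digit sequence `i : ℕ → Fin 3` (0-indexed):
`val(i) = β_{i₀} + Σ_{k≥1} β_{i_k} ∏_{r<k} p_{i_r}`. -/
noncomputable def P3val (p : Fin 3 → ℝ) (i : ℕ → Fin 3) : ℝ :=
  ∑' k : ℕ, P3beta p (i k) * ∏ r ∈ Finset.range k, p (i r)

/-- The digit permutation θ with θ(0)=0, θ(1)=2, θ(2)=1. -/
def P3theta : Fin 3 → Fin 3 := ![0, 2, 1]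

/-- The one-sided shift on digit sequences. -/
def P3shift (i : ℕ → Fin 3) : ℕ → Fin 3 := fun k => i (k + 1)

/-- The value of a digit sequence that is constant, equal to `c`, after position `m`. -/
theorem P3val_of_eventually_const (p : Fin 3 → ℝ) (hp : ∀ t, p t ∈ Set.Ioo (0 : ℝ) 1)
    (m : ℕ) (i : ℕ → Fin 3) (c : Fin 3) (hc : ∀ k, m < k → i k = c) :
    P3val p i = ∑ k ∈ Finset.range m, P3beta p (i k) * ∏ r ∈ Finset.range k, p (i r) +
      (∏ r ∈ Finset.range m, p (i r)) *
        (P3beta p (i m) + p (i m) * (P3beta p c / (1 - p c))) := by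
  have hprod : ∀ n, ∏ r ∈ Finset.range (n + (m + 1)), p (i r) =
      (∏ r ∈ Finset.range (m + 1), p (i r)) * p c ^ n := by
    intro n
    rw [add_comm n, Finset.prod_range_add]
    congr 1
    rw [Finset.prod_congr rfl (fun r _ => by rw [hc (m + 1 + r) (by lia)]), Finset.prod_const,
      Finset.card_range]
  have htail : HasSum (fun n => P3beta p (i (n + (m + 1))) *
      ∏ r ∈ Finset.range (n + (m + 1)), p (i r))
      (P3beta p c * (∏ r ∈ Finset.range (m + 1), p (i r)) * (1 - p c)⁻¹) := by
    have h := (hasSum_geometric_of_lt_one (hp c).1.le (hp c).2).mul_left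
      (P3beta p c * ∏ r ∈ Finset.range (m + 1), p (i r))
    refine h.congr_fun fun n => ?_
    rw [hprod, hc (n + (m + 1)) (by lia)]
    ring
  have h := ((hasSum_nat_add_iff (f := fun k => P3beta p (i k) *
    ∏ r ∈ Finset.range k, p (i r)) (m + 1)).1 htail).tsum_eq
  rw [P3val, h, Finset.sum_range_succ, Finset.prod_range_succ]
  ring

theorem stmt0 (p : Fin 3 → ℝ) (hp : ∀ t, p t ∈ Set.Ioo (0 : ℝ) 1)
    (hsum : p 0 + p 1 + p 2 = 1)
    (m : ℕ) (i j : ℕ → Fin 3)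
    (hpre : ∀ k < m, j k = i k)
    (him : i m ≠ 0)
    (hjm : (j m : ℕ) + 1 = (i m : ℕ))
    (hit : ∀ k, m < k → i k = 0)
    (hjt : ∀ k, m < k → j k = 2) :
    P3val p i = P3val p j ∧
      P3val p (fun k => P3theta (i k)) ≠ P3val p (fun k => P3theta (j k)) := by
  have hprod : ∀ (f : Fin 3 → Fin 3), ∀ k ≤ m,
      ∏ r ∈ Finset.range k, p (f (j r)) = ∏ r ∈ Finset.range k, p (f (i r)) := fun f k hk =>
    Finset.prod_congr rfl fun r hr => by rw [hpre r (by have := Finset.mem_range.1 hr; lia)]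
  have hpartial : ∀ (f : Fin 3 → Fin 3),
      ∑ k ∈ Finset.range m, P3beta p (f (j k)) * ∏ r ∈ Finset.range k, p (f (j r)) =
      ∑ k ∈ Finset.range m, P3beta p (f (i k)) * ∏ r ∈ Finset.range k, p (f (i r)) := fun f =>
    Finset.sum_congr rfl fun k hk => by
      have hk := Finset.mem_range.1 hk
      rw [hpre k hk, hprod f k hk.le]
  have hpos : (∏ r ∈ Finset.range m, p (P3theta (i r))) ≠ 0 :=
    Finset.prod_ne_zero_iff.2 fun r _ => (hp _).1.ne'
  have h0 := hp 0
  have h1 := hp 1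
  have h2 := hp 2
  simp only [Set.mem_Ioo] at h0 h1 h2
  have hcases : (i m = 1 ∧ j m = 0) ∨ (i m = 2 ∧ j m = 1) := by
    generalize i m = a at *
    generalize j m = b at *
    revert a b
    decide
  have hV2 : (p 0 + p 1) / (1 - p 2) = 1 := by
    rw [div_eq_one_iff_eq (by linarith)]
    linarith
  have hV1 : 0 < p 0 / (1 - p 1) := div_pos h0.1 (by linarith)
  have hV1' : p 0 / (1 - p 1) < 1 := by
    rw [div_lt_one (by linarith)]
    linarith
  constructor
  · rw [P3val_of_eventually_const p hp m i 0 hit, P3val_of_eventually_const p hp m j 2 hjt,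
      hpartial fun t => t, hprod (fun t => t) m le_rfl]
    rcases hcases with ⟨hi, hj⟩ | ⟨hi, hj⟩ <;> simp [hi, hj, P3beta, hV2]
  · rw [P3val_of_eventually_const p hp m (fun k => P3theta (i k)) 0
        fun k hk => by simp [hit k hk, P3theta],
      P3val_of_eventually_const p hp m (fun k => P3theta (j k)) 1
        fun k hk => by simp [hjt k hk, P3theta],
      hpartial P3theta, hprod P3theta m le_rfl]
    intro h
    have h := mul_left_cancel₀ hpos (add_left_cancel h)
    rcases hcases with ⟨hi, hj⟩ | ⟨hi, hj⟩ <;> simp [hi, hj, P3beta, P3theta] at h <;> nlinarith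
end

section
/- f(0) = 0, and x = 0 is the unique invariant point of f: for every admissible digit sequence i (not eventually constantly equal to 2), val(θ∘i) = val(i) holds if and only if val(i) = 0, i.e., if and only if i is the all-zero sequence. -/
open Filter MeasureTheory Finset

theorem P3beta_nonneg {p : Fin 3 → ℝ} (hp : ∀ t, p t ∈ Set.Ioo (0 : ℝ) 1) (t : Fin 3) :
    0 ≤ P3beta p t := by
  have h0 := (hp 0).1
  have h1 := (hp 1).1
  fin_cases t <;> simp [P3beta] <;> linarith

theorem P3beta_add_le_one {p : Fin 3 → ℝ} (hp : ∀ t, p t ∈ Set.Ioo (0 : ℝ) 1)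
    (hsum : p 0 + p 1 + p 2 = 1) (t : Fin 3) : P3beta p t + p t ≤ 1 := by
  have h1 := (hp 1).1
  have h2 := (hp 2).1
  fin_cases t <;> simp [P3beta] <;> linarith

theorem P3term_nonneg {p : Fin 3 → ℝ} (hp : ∀ t, p t ∈ Set.Ioo (0 : ℝ) 1) (i : ℕ → Fin 3)
    (k : ℕ) : 0 ≤ P3beta p (i k) * ∏ r ∈ Finset.range k, p (i r) :=
  mul_nonneg (P3beta_nonneg hp _) (Finset.prod_nonneg fun r _ => (hp (i r)).1.le)

theorem P3sum_add_prod_le_one {p : Fin 3 → ℝ} (hp : ∀ t, p t ∈ Set.Ioo (0 : ℝ) 1)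
    (hsum : p 0 + p 1 + p 2 = 1) (i : ℕ → Fin 3) (n : ℕ) :
    ∑ k ∈ Finset.range n, P3beta p (i k) * ∏ r ∈ Finset.range k, p (i r)
      + ∏ r ∈ Finset.range n, p (i r) ≤ 1 := by
  induction n with
  | zero => simp
  | succ n ih =>
    rw [Finset.sum_range_succ, Finset.prod_range_succ]
    have hprod : 0 ≤ ∏ r ∈ Finset.range n, p (i r) :=
      Finset.prod_nonneg fun r _ => (hp (i r)).1.le
    have := mul_le_mul_of_nonneg_right (P3beta_add_le_one hp hsum (i n)) hprod
    linarith

theorem P3sum_le_one {p : Fin 3 → ℝ} (hp : ∀ t, p t ∈ Set.Ioo (0 : ℝ) 1)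
    (hsum : p 0 + p 1 + p 2 = 1) (i : ℕ → Fin 3) (n : ℕ) :
    ∑ k ∈ Finset.range n, P3beta p (i k) * ∏ r ∈ Finset.range k, p (i r) ≤ 1 := by
  have hprod : 0 ≤ ∏ r ∈ Finset.range n, p (i r) :=
    Finset.prod_nonneg fun r _ => (hp (i r)).1.le
  linarith [P3sum_add_prod_le_one hp hsum i n]

theorem P3summable {p : Fin 3 → ℝ} (hp : ∀ t, p t ∈ Set.Ioo (0 : ℝ) 1)
    (hsum : p 0 + p 1 + p 2 = 1) (i : ℕ → Fin 3) :
    Summable fun k : ℕ => P3beta p (i k) * ∏ r ∈ Finset.range k, p (i r) :=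
  summable_of_sum_range_le (P3term_nonneg hp i) (P3sum_le_one hp hsum i)

theorem P3val_nonneg {p : Fin 3 → ℝ} (hp : ∀ t, p t ∈ Set.Ioo (0 : ℝ) 1) (i : ℕ → Fin 3) :
    0 ≤ P3val p i :=
  tsum_nonneg (P3term_nonneg hp i)

theorem P3val_le_one {p : Fin 3 → ℝ} (hp : ∀ t, p t ∈ Set.Ioo (0 : ℝ) 1)
    (hsum : p 0 + p 1 + p 2 = 1) (i : ℕ → Fin 3) : P3val p i ≤ 1 :=
  Real.tsum_le_of_sum_range_le (P3term_nonneg hp i) (P3sum_le_one hp hsum i)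

theorem P3val_eq_add {p : Fin 3 → ℝ} (hp : ∀ t, p t ∈ Set.Ioo (0 : ℝ) 1)
    (hsum : p 0 + p 1 + p 2 = 1) (i : ℕ → Fin 3) :
    P3val p i = P3beta p (i 0) + p (i 0) * P3val p (P3shift i) := by
  unfold P3val
  rw [(P3summable hp hsum i).tsum_eq_zero_add, ← tsum_mul_left]
  congr 1
  · simp
  · refine tsum_congr fun k => ?_
    rw [Finset.prod_range_succ']
    simp only [P3shift]
    ring

/-- A property of digit sequences that forces the first digit to be `d` and passes to the shift
holds only for the constant sequence `d`. -/
theorem eq_const_of_P3shift {P : (ℕ → Fin 3) → Prop} {d : Fin 3}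
    (hP : ∀ i, P i → i 0 = d ∧ P (P3shift i)) {i : ℕ → Fin 3} (hi : P i) : i = fun _ => d := by
  funext k
  induction k generalizing i with
  | zero => exact (hP i hi).1
  | succ k ih => exact ih (hP i hi).2

theorem P3val_zero (p : Fin 3 → ℝ) : P3val p (fun _ => 0) = 0 := by
  simp [P3val, P3beta]

theorem P3val_eq_zero_iff {p : Fin 3 → ℝ} (hp : ∀ t, p t ∈ Set.Ioo (0 : ℝ) 1)
    (hsum : p 0 + p 1 + p 2 = 1) (i : ℕ → Fin 3) : P3val p i = 0 ↔ i = fun _ => 0 := by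
  refine ⟨eq_const_of_P3shift (P := fun j => P3val p j = 0) fun j hj => ?_,
    fun h => h ▸ P3val_zero p⟩
  have h0 := (hp 0).1
  have h1 := (hp 1).1
  have hv := mul_nonneg (hp (j 0)).1.le (P3val_nonneg hp (P3shift j))
  rw [P3val_eq_add hp hsum] at hj
  have hd : j 0 = 0 := by
    generalize j 0 = d at hj hv
    fin_cases d <;> simp [P3beta] at hj hv ⊢ <;> linarith
  refine ⟨hd, ?_⟩
  simpa [hd, P3beta, h0.ne'] using hj

theorem eq_two_of_P3val_eq_one {p : Fin 3 → ℝ} (hp : ∀ t, p t ∈ Set.Ioo (0 : ℝ) 1)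
    (hsum : p 0 + p 1 + p 2 = 1) {i : ℕ → Fin 3} (hi : P3val p i = 1) : i = fun _ => 2 := by
  refine eq_const_of_P3shift (P := fun j => P3val p j = 1) (fun j hj => ?_) hi
  have h1 := (hp 1).1
  have h2 := (hp 2).1
  have hv := mul_le_of_le_one_right (hp (j 0)).1.le (P3val_le_one hp hsum (P3shift j))
  rw [P3val_eq_add hp hsum] at hj
  have hd : j 0 = 2 := by
    generalize j 0 = d at hj hv
    fin_cases d <;> simp [P3beta] at hj hv ⊢ <;> linarith
  refine ⟨hd, mul_left_cancel₀ h2.ne' ?_⟩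
  simp [hd, P3beta] at hj
  linarith

theorem P3theta_zero : P3theta 0 = 0 := rfl

theorem P3theta_one : P3theta 1 = 2 := rfl

theorem P3theta_two : P3theta 2 = 1 := rfl

theorem eq_zero_of_P3val_theta_eq {p : Fin 3 → ℝ} (hp : ∀ t, p t ∈ Set.Ioo (0 : ℝ) 1)
    (hsum : p 0 + p 1 + p 2 = 1) {i : ℕ → Fin 3} (hi : ¬ ∃ N, ∀ k ≥ N, i k = 2)
    (hfix : P3val p (fun k => P3theta (i k)) = P3val p i) : i = fun _ => 0 := by
  refine eq_const_of_P3shift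
    (P := fun j => (¬ ∃ N, ∀ k ≥ N, j k = 2) ∧ P3val p (fun k => P3theta (j k)) = P3val p j)
    (fun j ⟨hj, hfix⟩ => ?_) ⟨hi, hfix⟩
  have h0 := (hp 0).1
  have h1 := (hp 1).1
  have h2 := (hp 2).1
  have hshift : ¬ ∃ N, ∀ k ≥ N, P3shift j k = 2 := by
    rintro ⟨N, hN⟩
    refine hj ⟨N + 1, fun k hk => ?_⟩
    obtain ⟨m, rfl⟩ := Nat.exists_eq_add_of_le' (show 1 ≤ k by omega)
    exact hN m (by omega)
  rw [P3val_eq_add hp hsum j, P3val_eq_add hp hsum fun k => P3theta (j k)] at hfix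
  have hcomm : P3shift (fun k => P3theta (j k)) = fun k => P3theta (P3shift j k) := rfl
  rw [hcomm] at hfix
  have hv0 := P3val_nonneg hp (P3shift j)
  have hv1 := P3val_le_one hp hsum (P3shift j)
  have hw0 := P3val_nonneg hp fun k => P3theta (P3shift j k)
  have hw1 := P3val_le_one hp hsum fun k => P3theta (P3shift j k)
  have hcases : j 0 = 0 ∨ j 0 = 1 ∨ j 0 = 2 := by
    generalize j 0 = d
    fin_cases d <;> simp
  rcases hcases with hd | hd | hd <;>
    simp [hd, P3theta_zero, P3theta_one, P3theta_two, P3beta] at hfix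
  · exact ⟨hd, hshift, hfix.resolve_right h0.ne'⟩
  · have hone : P3val p (P3shift j) = 1 := by nlinarith
    have htwo := eq_two_of_P3val_eq_one hp hsum hone
    exact absurd ⟨0, fun k _ => congrFun htwo k⟩ hshift
  · have hzero : P3val p (P3shift j) = 0 := by nlinarith
    have hone : P3val p (fun k => P3theta (P3shift j k)) = 1 := by nlinarith
    rw [P3val_eq_zero_iff hp hsum] at hzero
    have htwo := congrFun (eq_two_of_P3val_eq_one hp hsum hone) 0
    simp [hzero, P3theta_zero] at htwo

theorem stmt1 (p : Fin 3 → ℝ) (hp : ∀ t, p t ∈ Set.Ioo (0 : ℝ) 1)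
    (hsum : p 0 + p 1 + p 2 = 1) :
    P3val p (fun _ => P3theta 0) = 0 ∧
      ∀ i : ℕ → Fin 3, (¬ ∃ N, ∀ k ≥ N, i k = 2) →
        ((P3val p (fun k => P3theta (i k)) = P3val p i ↔ P3val p i = 0) ∧
          (P3val p i = 0 ↔ i = fun _ => 0)) := by
  have hzero := P3val_eq_zero_iff hp hsum
  refine ⟨P3val_zero p, fun i hi => ⟨⟨fun h => ?_, fun h => ?_⟩, hzero i⟩⟩
  · exact (hzero i).2 (eq_zero_of_P3val_theta_eq hp hsum hi h)
  · rw [(hzero i).1 h]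
    rfl
end

section
/- For any finite tuple of digits c₁,…,c_{k₀} ∈ {0,1,2} (k₀ ≥ 0), let x₁ = val(c₁,…,c_{k₀}, 1, 0, 0, 0, …) and x₂ = val(c₁,…,c_{k₀}, 2, 1, 1, 1, …). Then x₁ ≠ x₂ but f(x₁) = f(x₂), i.e., val(θ(c₁),…,θ(c_{k₀}), 2, 0, 0, 0, …) = val(θ(c₁),…,θ(c_{k₀}), 1, 2, 2, 2, …). -/
open Filter MeasureTheory Finset

theorem P3val_summable {p : Fin 3 → ℝ} (hp : ∀ t, p t ∈ Set.Ioo (0 : ℝ) 1) (i : ℕ → Fin 3) :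
    Summable fun k : ℕ => P3beta p (i k) * ∏ r ∈ Finset.range k, p (i r) := by
  obtain ⟨t₀, ht₀⟩ := Finite.exists_max p
  obtain ⟨t₁, ht₁⟩ := Finite.exists_max fun t => |P3beta p t|
  refine Summable.of_norm_bounded
    ((summable_geometric_of_lt_one (hp t₀).1.le (hp t₀).2).mul_left |P3beta p t₁|) fun k => ?_
  rw [Real.norm_eq_abs, abs_mul, Finset.abs_prod]
  refine mul_le_mul (ht₁ (i k)) ?_ (by positivity) (abs_nonneg _)
  calc ∏ r ∈ Finset.range k, |p (i r)| ≤ ∏ _r ∈ Finset.range k, p t₀ :=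
        Finset.prod_le_prod (fun _ _ => abs_nonneg _) fun r _ => by
          rw [abs_of_pos (hp (i r)).1]; exact ht₀ (i r)
    _ = p t₀ ^ k := by simp

theorem P3val_eq_head_add {p : Fin 3 → ℝ} (hp : ∀ t, p t ∈ Set.Ioo (0 : ℝ) 1)
    (i : ℕ → Fin 3) :
    P3val p i = P3beta p (i 0) + p (i 0) * P3val p (P3shift i) := by
  unfold P3val
  rw [(P3val_summable hp i).tsum_eq_zero_add, ← tsum_mul_left]
  congr 1
  · simp
  · refine tsum_congr fun k => ?_
    rw [Finset.prod_range_succ']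
    simp only [P3shift]
    ring

theorem P3val_eq_iff_of_prefix {p : Fin 3 → ℝ} (hp : ∀ t, p t ∈ Set.Ioo (0 : ℝ) 1)
    (n : ℕ) {i j : ℕ → Fin 3} (h : ∀ k < n, i k = j k) :
    P3val p i = P3val p j ↔
      P3val p (fun k => i (k + n)) = P3val p (fun k => j (k + n)) := by
  induction n generalizing i j with
  | zero => rfl
  | succ n ih =>
    rw [P3val_eq_head_add hp i, P3val_eq_head_add hp j, h 0 n.succ_pos, add_right_inj,
      mul_right_inj' (hp (j 0)).1.ne',
      ih (i := P3shift i) (j := P3shift j) fun k hk => h (k + 1) (by lia)]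
    rfl

/-- The value of a digit `a` followed by the constant tail `b, b, b, …`. -/
theorem P3val_digit_const {p : Fin 3 → ℝ} (hp : ∀ t, p t ∈ Set.Ioo (0 : ℝ) 1)
    {i : ℕ → Fin 3} {a b : Fin 3} (ha : i 0 = a) (hb : ∀ k, i (k + 1) = b) :
    P3val p i = P3beta p a + p a * (P3beta p b / (1 - p b)) := by
  have hconst : P3val p (fun _ => b) = P3beta p b / (1 - p b) := by
    have h := P3val_eq_head_add hp fun _ => b
    change P3val p (fun _ => b) = P3beta p b + p b * P3val p (fun _ => b) at h
    rw [eq_div_iff (sub_pos.2 (hp b).2).ne']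
    linarith
  have hshift : P3shift i = fun _ => b := funext hb
  rw [P3val_eq_head_add hp i, hshift, ha, hconst]

theorem stmt3 (p : Fin 3 → ℝ) (hp : ∀ t, p t ∈ Set.Ioo (0 : ℝ) 1)
    (hsum : p 0 + p 1 + p 2 = 1)
    (f : ℝ → ℝ)
    (hf : ∀ i : ℕ → Fin 3, (¬ ∃ N, ∀ k ≥ N, i k = 2) →
      f (P3val p i) = P3val p (fun k => P3theta (i k)))
    (k0 : ℕ) (c : ℕ → Fin 3) (i1 i2 : ℕ → Fin 3)
    (h1 : i1 = fun k => if k < k0 then c k else if k = k0 then 1 else 0)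
    (h2 : i2 = fun k => if k < k0 then c k else if k = k0 then 2 else 1) :
    P3val p i1 ≠ P3val p i2 ∧
      P3val p (fun k => P3theta (i1 k)) = P3val p (fun k => P3theta (i2 k)) ∧
      f (P3val p i1) = f (P3val p i2) := by
  have h0 := hp 0
  have h1p := hp 1
  have h2p := hp 2
  simp only [Set.mem_Ioo] at h0 h1p h2p
  have hθ : P3val p (fun k => P3theta (i1 k)) = P3val p (fun k => P3theta (i2 k)) := by
    rw [P3val_eq_iff_of_prefix hp k0 (fun k hk => by simp [h1, h2, hk]),
      P3val_digit_const hp (a := 2) (b := 0) (by simp [h1, P3theta]) (by simp [h1, P3theta]),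
      P3val_digit_const hp (a := 1) (b := 2) (by simp [h2, P3theta]) (by simp [h2, P3theta])]
    have hone : (p 0 + p 1) / (1 - p 2) = 1 := by
      rw [div_eq_one_iff_eq (by linarith)]
      linarith
    simp [P3beta, hone]
  refine ⟨?_, hθ, ?_⟩
  · rw [Ne, P3val_eq_iff_of_prefix hp k0 (fun k hk => by simp [h1, h2, hk]),
      P3val_digit_const hp (a := 1) (b := 0) (by simp [h1]) (by simp [h1]),
      P3val_digit_const hp (a := 2) (b := 1) (by simp [h2]) (by simp [h2])]
    have hpos : 0 < p 2 * (p 0 / (1 - p 1)) :=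
      mul_pos h2p.1 (div_pos h0.1 (by linarith))
    simp only [P3beta, Matrix.cons_val_zero, Matrix.cons_val_one, Matrix.cons_val]
    intro h
    simp only [zero_div, mul_zero, add_zero] at h
    linarith
  · have hlast (i : ℕ → Fin 3) (b : Fin 3) (hb : b ≠ 2) (hi : ∀ k > k0, i k = b) :
        ¬ ∃ N, ∀ k ≥ N, i k = 2 := fun ⟨N, hN⟩ =>
      hb ((hi (N + k0 + 1) (by lia)).symm.trans (hN _ (by lia)))
    rw [hf i1 (hlast i1 0 (by decide) fun k hk => by simp [h1, hk.not_gt, hk.ne']),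
      hf i2 (hlast i2 1 (by decide) fun k hk => by simp [h2, hk.not_gt, hk.ne']), hθ]
end

section
/- The function f is not monotone on [0,1]: it is neither monotonically nondecreasing nor monotonically nonincreasing on its domain. In particular, there exist x₁ < x₂ with f(x₁) < f(x₂) and there exist x₁ < x₂ with f(x₁) > f(x₂). -/
open Filter MeasureTheory Finset

/-- The digit sequence `d, 0, 0, …` has value `β_d`. -/
theorem P3val_single (p : Fin 3 → ℝ) (d : Fin 3) : P3val p (Pi.single 0 d) = P3beta p d := by
  rw [P3val, tsum_eq_single 0]
  · simp
  · intro k hk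
    simp [Pi.single_eq_of_ne hk, P3beta]

theorem P3theta_single (d : Fin 3) :
    (fun k : ℕ => P3theta ((Pi.single 0 d : ℕ → Fin 3) k)) = Pi.single 0 (P3theta d) := by
  funext k
  rcases eq_or_ne k 0 with rfl | hk
  · simp
  · simp [Pi.single_eq_of_ne hk, P3theta]

theorem single_not_eventually_two (d : Fin 3) :
    ¬ ∃ N, ∀ k ≥ N, (Pi.single 0 d : ℕ → Fin 3) k = 2 := by
  rintro ⟨N, hN⟩
  have h := hN (N + 1) N.le_succ
  rw [Pi.single_eq_of_ne N.succ_ne_zero] at h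
  exact absurd h (by decide)

theorem stmt5 (p : Fin 3 → ℝ) (hp : ∀ t, p t ∈ Set.Ioo (0 : ℝ) 1)
    (hsum : p 0 + p 1 + p 2 = 1)
    (f : ℝ → ℝ)
    (hf : ∀ i : ℕ → Fin 3, (¬ ∃ N, ∀ k ≥ N, i k = 2) →
      f (P3val p i) = P3val p (fun k => P3theta (i k)))
    (hrep : ∀ x ∈ Set.Ico (0 : ℝ) 1, ∃ i : ℕ → Fin 3,
      (¬ ∃ N, ∀ k ≥ N, i k = 2) ∧ P3val p i = x) :
    ¬ MonotoneOn f (Set.Icc 0 1) ∧ ¬ AntitoneOn f (Set.Icc 0 1) ∧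
      (∃ x₁ ∈ Set.Icc (0 : ℝ) 1, ∃ x₂ ∈ Set.Icc (0 : ℝ) 1, x₁ < x₂ ∧ f x₁ < f x₂) ∧
      (∃ x₁ ∈ Set.Icc (0 : ℝ) 1, ∃ x₂ ∈ Set.Icc (0 : ℝ) 1, x₁ < x₂ ∧ f x₂ < f x₁) := by
  have key (d : Fin 3) : f (P3beta p d) = P3beta p (P3theta d) := by
    rw [← P3val_single, hf _ (single_not_eventually_two d), P3theta_single, P3val_single]
  have f0 : f 0 = 0 := by simpa [P3beta, P3theta] using key 0
  have f1 : f (p 0) = p 0 + p 1 := by simpa [P3beta, P3theta] using key 1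
  have f2 : f (p 0 + p 1) = p 0 := by simpa [P3beta, P3theta] using key 2
  obtain ⟨h0, -⟩ := hp 0
  obtain ⟨h1, -⟩ := hp 1
  obtain ⟨h2, -⟩ := hp 2
  have m0 : (0 : ℝ) ∈ Set.Icc (0 : ℝ) 1 := by simp
  have m1 : p 0 ∈ Set.Icc (0 : ℝ) 1 := ⟨by linarith, by linarith⟩
  have m2 : p 0 + p 1 ∈ Set.Icc (0 : ℝ) 1 := ⟨by linarith, by linarith⟩
  refine ⟨fun h => ?_, fun h => ?_, ⟨0, m0, p 0, m1, h0, by linarith⟩,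
    ⟨p 0, m1, p 0 + p 1, m2, by linarith, by linarith⟩⟩
  · have := h m1 m2 (by linarith)
    linarith
  · have := h m0 m1 h0.le
    linarith
end
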